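/- arXiv:0804.1485 — 2 statements merged into one kernel-verified Lean document; each statement's English description precedes it below -/
import Mathlib

section
/- For every λ ∈ P^+, the stabilizer {τ ∈ T : τλ = λ} of λ in the monoid T equals the submonoid of T generated by {r_i : i ∈ I, α_i^∨(λ) = 0}. -/
namespace GKM

variable {I V : Type*} [AddCommGroup V] [Module ℚ V]

/-- The simple "reflection" `r_i : x ↦ x - α_i^∨(x) • α_i` (an endomorphism of `h*`). -/
def srefl (α : I → V) (coroot : I → (V →ₗ[ℚ] ℚ)) (i : I) : Module.End ℚ V :=
  LinearMap.id - (coroot i).smulRight (α i)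

/-- The dual map `h ↦ h - h(α_i) • α_i^∨` on linear functionals; for a real index `i`
this is `r_i^∨ : h ↦ h ∘ r_i⁻¹ = h ∘ r_i`. -/
def crefl (α : I → V) (coroot : I → (V →ₗ[ℚ] ℚ)) (i : I) :
    Module.End ℚ (V →ₗ[ℚ] ℚ) :=
  LinearMap.id - (LinearMap.applyₗ (α i)).smulRight (coroot i)

/-- The monoid `T` generated by all the `r_i`, `i ∈ I`. -/
def Tmon (α : I → V) (coroot : I → (V →ₗ[ℚ] ℚ)) : Submonoid (Module.End ℚ V) :=
  Submonoid.closure (Set.range (srefl α coroot))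

/-- The Weyl group `W` generated by the `r_i` with `i` real; since each generator is an
involution, the submonoid it generates coincides with the group it generates. -/
def Wmon (A : I → I → ℤ) (α : I → V) (coroot : I → (V →ₗ[ℚ] ℚ)) :
    Submonoid (Module.End ℚ V) :=
  Submonoid.closure (srefl α coroot '' {i | A i i = 2})

/-- `Q^+`, the set of `ℕ`-linear combinations of simple roots. -/
def Qplus (α : I → V) : Set V :=
  {x | ∃ c : I →₀ ℕ, x = c.sum fun i n => (n : ℚ) • α i}

/-- The weight lattice `P`. -/
def Pint (coroot : I → (V →ₗ[ℚ] ℚ)) : Set V :=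
  {x | ∀ i, ∃ n : ℤ, coroot i x = (n : ℚ)}

/-- The dominant integral weights `P^+`. -/
def Pplus (coroot : I → (V →ₗ[ℚ] ℚ)) : Set V :=
  {x | (∀ i, ∃ n : ℤ, coroot i x = (n : ℚ)) ∧ ∀ i, 0 ≤ coroot i x}

/-- The orbit `Tλ`. -/
def Torbit (α : I → V) (coroot : I → (V →ₗ[ℚ] ℚ)) (lam : V) : Set V :=
  {x | ∃ τ, τ ∈ Tmon α coroot ∧ τ lam = x}

/-- The reduced length of `τ ∈ T` with respect to all generators `r_i`, `i ∈ I`. -/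
noncomputable def lenT (α : I → V) (coroot : I → (V →ₗ[ℚ] ℚ))
    (τ : Module.End ℚ V) : ℕ :=
  sInf {n | ∃ l : List I, l.length = n ∧ (l.map (srefl α coroot)).prod = τ}

/-- The reduced length of `w ∈ W` with respect to the real generators. -/
noncomputable def lenW (A : I → I → ℤ) (α : I → V) (coroot : I → (V →ₗ[ℚ] ℚ))
    (w : Module.End ℚ V) : ℕ :=
  sInf {n | ∃ l : List I, (∀ m ∈ l, A m m = 2) ∧ l.length = n ∧
    (l.map (srefl α coroot)).prod = w}

/-- The reflection `r_β : x ↦ x - β^∨(x) • β` attached to a root/coroot pair. -/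
def reflRoot (β : V) (βv : V →ₗ[ℚ] ℚ) : Module.End ℚ V :=
  LinearMap.id - βv.smulRight β

/-- A presentation of `β = w α_k ∈ WΠ` together with its coroot `β^∨ = w^∨ α_k^∨`,
via a word `l` (with real entries) for `w`. -/
def IsWRootPres (A : I → I → ℤ) (α : I → V) (coroot : I → (V →ₗ[ℚ] ℚ))
    (l : List I) (k : I) (β : V) (βv : V →ₗ[ℚ] ℚ) : Prop :=
  (∀ m ∈ l, A m m = 2) ∧
  β = (l.map (srefl α coroot)).prod (α k) ∧
  βv = (l.map (crefl α coroot)).prod (coroot k)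

/-- `β ∈ WΠ` with coroot `β^∨`. -/
def IsWRootPair (A : I → I → ℤ) (α : I → V) (coroot : I → (V →ₗ[ℚ] ℚ))
    (β : V) (βv : V →ₗ[ℚ] ℚ) : Prop :=
  ∃ l k, IsWRootPres A α coroot l k β βv

/-- A chain `ν =: c s ← ⋯ ← c 0 := μ` of length `s` inside `Tλ`:
`c k = r_{β k} (c (k+1))` with `β k ∈ WΠ ∩ Q^+` and `(β k)^∨(c (k+1)) > 0`. -/
def IsChain (A : I → I → ℤ) (α : I → V) (coroot : I → (V →ₗ[ℚ] ℚ))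
    (lam μ ν : V) (s : ℕ) (c : ℕ → V) (β : ℕ → V)
    (βv : ℕ → (V →ₗ[ℚ] ℚ)) : Prop :=
  c 0 = μ ∧ c s = ν ∧ (∀ k ≤ s, c k ∈ Torbit α coroot lam) ∧
  ∀ k < s, IsWRootPair A α coroot (β k) (βv k) ∧ β k ∈ Qplus α ∧
    0 < βv k (c (k+1)) ∧ c k = c (k+1) - βv k (c (k+1)) • β k

/-- `μ > ν` in `Tλ`. -/
def ChainGT (A : I → I → ℤ) (α : I → V) (coroot : I → (V →ₗ[ℚ] ℚ))
    (lam μ ν : V) : Prop :=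
  ∃ s, 1 ≤ s ∧ ∃ c β βv, IsChain A α coroot lam μ ν s c β βv

/-- `dist(μ, ν) = n`: there is a chain of length `n` from `μ` to `ν` and every chain
has length at most `n`. -/
def distEq (A : I → I → ℤ) (α : I → V) (coroot : I → (V →ₗ[ℚ] ℚ))
    (lam μ ν : V) (n : ℕ) : Prop :=
  (∃ c β βv, IsChain A α coroot lam μ ν n c β βv) ∧
  ∀ m c β βv, IsChain A α coroot lam μ ν m c β βv → m ≤ n

/-- An `a`-chain for `(μ, ν)`: a chain in which each step is a covering
(`dist = 1`), `a·β_k^∨(ν_k)` is a positive integer for steps along `WΠ_re`,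
and `a·β_k^∨(ν_k) = 1` for steps along `WΠ_im`.  The index `ks k` records the simple
root of which `β k` is a `W`-translate. -/
def IsAChain (A : I → I → ℤ) (α : I → V) (coroot : I → (V →ₗ[ℚ] ℚ))
    (lam : V) (a : ℚ) (μ ν : V) (s : ℕ) (c : ℕ → V)
    (β : ℕ → V) (βv : ℕ → (V →ₗ[ℚ] ℚ)) (ks : ℕ → I) : Prop :=
  1 ≤ s ∧ IsChain A α coroot lam μ ν s c β βv ∧
  ∀ k < s,
    (∃ l, IsWRootPres A α coroot l (ks k) (β k) (βv k)) ∧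
    distEq A α coroot lam (c k) (c (k+1)) 1 ∧
    (A (ks k) (ks k) = 2 → ∃ n : ℕ, 0 < n ∧ a * βv k (c (k+1)) = (n : ℚ)) ∧
    (A (ks k) (ks k) ≠ 2 → a * βv k (c (k+1)) = 1)

/-- Existence of an `a`-chain for `(μ, ν)`. -/
def HasAChain (A : I → I → ℤ) (α : I → V) (coroot : I → (V →ₗ[ℚ] ℚ))
    (lam : V) (a : ℚ) (μ ν : V) : Prop :=
  ∃ s c β βv ks, IsAChain A α coroot lam a μ ν s c β βv ks

/-- The piecewise-linear path attached to GLS data `(λ_1, …, λ_s ; a_0, …, a_s)`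
(weights indexed `1, …, s`, breakpoints indexed `0, …, s`):
on `[a_{j-1}, a_j]` it equals `Σ_{k<j} (a_k - a_{k-1}) • λ_k + (t - a_{j-1}) • λ_j`. -/
def glsPath (lamseq : ℕ → V) (a : ℕ → ℚ) (s : ℕ) (t : ℚ) : V :=
  ∑ k ∈ Finset.range s, (max (min t (a (k+1)) - a k) 0) • lamseq (k+1)

/-- The data of a Generalized Lakshmibai–Seshadri path of shape `lam`. -/
def IsGLS (A : I → I → ℤ) (α : I → V) (coroot : I → (V →ₗ[ℚ] ℚ))
    (lam : V) (s : ℕ) (lamseq : ℕ → V) (a : ℕ → ℚ) : Prop :=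
  1 ≤ s ∧ a 0 = 0 ∧ a s = 1 ∧ (∀ k < s, a k < a (k+1)) ∧
  (∀ k, 1 ≤ k → k ≤ s → lamseq k ∈ Torbit α coroot lam) ∧
  (∀ k, 1 ≤ k → k < s →
    HasAChain A α coroot lam (a k) (lamseq k) (lamseq (k+1))) ∧
  (lamseq s = lam ∨ HasAChain A α coroot lam 1 (lamseq s) lam)

/-- The set `ℙ_λ` of Generalized Lakshmibai–Seshadri paths of shape `lam`,
realized as functions `ℚ → V` via `glsPath`. -/
def GLSset (A : I → I → ℤ) (α : I → V) (coroot : I → (V →ₗ[ℚ] ℚ))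
    (lam : V) : Set (ℚ → V) :=
  {π | ∃ s lamseq a, IsGLS A α coroot lam s lamseq a ∧ π = glsPath lamseq a s}

/-- `h_i^π(t) = α_i^∨(π(t))`. -/
def hFun (coroot : I → (V →ₗ[ℚ] ℚ)) (i : I) (π : ℚ → V) (t : ℚ) : ℚ :=
  coroot i (π t)

/-- `m_i^π`, the minimal integer value attained by `h_i^π` on `[0,1]`. -/
noncomputable def mOf (coroot : I → (V →ₗ[ℚ] ℚ)) (i : I) (π : ℚ → V) : ℤ :=
  sInf {n : ℤ | ∃ t, 0 ≤ t ∧ t ≤ 1 ∧ hFun coroot i π t = (n : ℚ)}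

/-- Two paths agree on `[0,1]`. -/
def pathEq (π π' : ℚ → V) : Prop := ∀ t, 0 ≤ t → t ≤ 1 → π t = π' t

/-- `tp = f_+^i(π)`: the largest point of `[0,1]` where `h_i^π` equals `m_i^π`. -/
def IsFPlus (coroot : I → (V →ₗ[ℚ] ℚ)) (i : I) (π : ℚ → V) (tp : ℚ) : Prop :=
  0 ≤ tp ∧ tp ≤ 1 ∧ hFun coroot i π tp = (mOf coroot i π : ℚ) ∧
  ∀ t, 0 ≤ t → t ≤ 1 → hFun coroot i π t = (mOf coroot i π : ℚ) → t ≤ tp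

/-- `tm = f_-^i(π)`: the smallest point of `[tp,1]` where `h_i^π` equals `m_i^π + 1`. -/
def IsFMinus (coroot : I → (V →ₗ[ℚ] ℚ)) (i : I) (π : ℚ → V) (tp tm : ℚ) : Prop :=
  tp ≤ tm ∧ tm ≤ 1 ∧ hFun coroot i π tm = (mOf coroot i π : ℚ) + 1 ∧
  ∀ t, tp ≤ t → t ≤ 1 → hFun coroot i π t = (mOf coroot i π : ℚ) + 1 → tm ≤ t

/-- The path `f_i π` (for cutting data `tp = f_+^i(π)`, `tm = f_-^i(π)`). -/
def fPath (α : I → V) (coroot : I → (V →ₗ[ℚ] ℚ)) (i : I) (tp tm : ℚ)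
    (π : ℚ → V) (t : ℚ) : V :=
  if t ≤ tp then π t
  else if t ≤ tm then π tp + srefl α coroot i (π t - π tp)
  else π t - α i

/-- `π' = f_i π ≠ 0` (equality of paths on `[0,1]`). -/
def FRel (α : I → V) (coroot : I → (V →ₗ[ℚ] ℚ)) (i : I) (π π' : ℚ → V) : Prop :=
  ∃ tp tm, IsFPlus coroot i π tp ∧ tp < 1 ∧ IsFMinus coroot i π tp tm ∧
    pathEq π' (fPath α coroot i tp tm π)

/-- `tp = e_+^i(π)` (`i` real): smallest point of `[0,1]` where `h_i^π = m_i^π`. -/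
def IsEPlusRe (coroot : I → (V →ₗ[ℚ] ℚ)) (i : I) (π : ℚ → V) (tp : ℚ) : Prop :=
  0 ≤ tp ∧ tp ≤ 1 ∧ hFun coroot i π tp = (mOf coroot i π : ℚ) ∧
  ∀ t, 0 ≤ t → t ≤ 1 → hFun coroot i π t = (mOf coroot i π : ℚ) → tp ≤ t

/-- `tm = e_-^i(π)` (`i` real): largest point of `[0,tp]` where `h_i^π = m_i^π + 1`. -/
def IsEMinusRe (coroot : I → (V →ₗ[ℚ] ℚ)) (i : I) (π : ℚ → V) (tp tm : ℚ) : Prop :=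
  0 ≤ tm ∧ tm ≤ tp ∧ hFun coroot i π tm = (mOf coroot i π : ℚ) + 1 ∧
  ∀ t, 0 ≤ t → t ≤ tp → hFun coroot i π t = (mOf coroot i π : ℚ) + 1 → t ≤ tm

/-- The path `e_i π` for `i` real. -/
def ePathRe (α : I → V) (coroot : I → (V →ₗ[ℚ] ℚ)) (i : I) (tm tp : ℚ)
    (π : ℚ → V) (t : ℚ) : V :=
  if t ≤ tm then π t
  else if t ≤ tp then π tm + srefl α coroot i (π t - π tm)
  else π t + α i

/-- `π' = e_i π ≠ 0` for a real index `i`. -/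
def ERelRe (α : I → V) (coroot : I → (V →ₗ[ℚ] ℚ)) (i : I) (π π' : ℚ → V) : Prop :=
  ∃ tp tm, IsEPlusRe coroot i π tp ∧ 0 < tp ∧ IsEMinusRe coroot i π tp tm ∧
    pathEq π' (ePathRe α coroot i tm tp π)

/-- The "inverse reflection" `r_i^{-1} : x ↦ x + (1/(1-a_{ii})) α_i^∨(x) α_i`
for an imaginary index `i`. -/
def rinv (A : I → I → ℤ) (α : I → V) (coroot : I → (V →ₗ[ℚ] ℚ)) (i : I) :
    Module.End ℚ V :=
  LinearMap.id + (1 / (1 - (A i i : ℚ))) • (coroot i).smulRight (α i)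

/-- `tp = e_+^i(π)` (`i` imaginary): smallest point of `[tm,1]` where
`h_i^π = m_i^π + 1 - a_{ii}` (here `tm = e_-^i(π) = f_+^i(π)`). -/
def IsEPlusIm (A : I → I → ℤ) (coroot : I → (V →ₗ[ℚ] ℚ)) (i : I) (π : ℚ → V)
    (tm tp : ℚ) : Prop :=
  tm ≤ tp ∧ tp ≤ 1 ∧
  hFun coroot i π tp = (mOf coroot i π : ℚ) + 1 - (A i i : ℚ) ∧
  ∀ t, tm ≤ t → t ≤ 1 →
    hFun coroot i π t = (mOf coroot i π : ℚ) + 1 - (A i i : ℚ) → tp ≤ t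

/-- The path `e_i π` for `i` imaginary. -/
def ePathIm (A : I → I → ℤ) (α : I → V) (coroot : I → (V →ₗ[ℚ] ℚ)) (i : I)
    (tm tp : ℚ) (π : ℚ → V) (t : ℚ) : V :=
  if t ≤ tm then π t
  else if t ≤ tp then π tm + rinv A α coroot i (π t - π tm)
  else π t + α i

/-- `π' = e_i π ≠ 0` for an imaginary index `i`:  `e_-^i(π) = f_+^i(π) < 1`, the point
`e_+^i(π)` exists, and `h_i^π` never drops to `m_i^π - a_{ii}` on `[e_+^i(π), 1]`. -/
def ERelIm (A : I → I → ℤ) (α : I → V) (coroot : I → (V →ₗ[ℚ] ℚ)) (i : I)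
    (π π' : ℚ → V) : Prop :=
  ∃ tm tp, IsFPlus coroot i π tm ∧ tm < 1 ∧ IsEPlusIm A coroot i π tm tp ∧
    (∀ t, tp ≤ t → t ≤ 1 →
      (mOf coroot i π : ℚ) - (A i i : ℚ) < hFun coroot i π t) ∧
    pathEq π' (ePathIm A α coroot i tm tp π)

/-- `π' = e_i π ≠ 0`. -/
def ERel (A : I → I → ℤ) (α : I → V) (coroot : I → (V →ₗ[ℚ] ℚ)) (i : I)
    (π π' : ℚ → V) : Prop :=
  (A i i = 2 ∧ ERelRe α coroot i π π') ∨ (A i i ≠ 2 ∧ ERelIm A α coroot i π π')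

/-- `π' = f_{i_1} ⋯ f_{i_k} π ≠ 0` for a list `[i_1, …, i_k]` (rightmost acts first). -/
def FMonRel (α : I → V) (coroot : I → (V →ₗ[ℚ] ℚ)) :
    List I → (ℚ → V) → (ℚ → V) → Prop
  | [], π, π' => pathEq π π'
  | i :: l, π, π' => ∃ πm, FMonRel α coroot l π πm ∧ FRel α coroot i πm π'

/-- A generalized crystal for the Borcherds–Cartan datum `(A, α, coroot)`. -/
structure GenCrystal (A : I → I → ℤ) (α : I → V)
    (coroot : I → (V →ₗ[ℚ] ℚ)) where
  B : Type*
  wt : B → V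
  wt_int : ∀ (i : I) (b : B), ∃ n : ℤ, coroot i (wt b) = (n : ℚ)
  eps : I → B → WithBot ℤ
  phi : I → B → WithBot ℤ
  e : I → B → Option B
  f : I → B → Option B
  phi_eq : ∀ (i : I) (b : B) (n : ℤ), (n : ℚ) = coroot i (wt b) →
    phi i b = eps i b + (n : WithBot ℤ)
  wt_e : ∀ (i : I) (b b' : B), e i b = some b' → wt b' = wt b + α i
  eps_e_re : ∀ (i : I) (b b' : B), A i i = 2 → e i b = some b' →
    eps i b' = eps i b + ((-1 : ℤ) : WithBot ℤ)
  eps_e_im : ∀ (i : I) (b b' : B), A i i ≠ 2 → e i b = some b' →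
    eps i b' = eps i b
  e_iff_f : ∀ (i : I) (b b' : B), e i b = some b' ↔ f i b' = some b
  phi_bot : ∀ (i : I) (b : B), phi i b = ⊥ → e i b = none ∧ f i b = none
  eps_im : ∀ (i : I) (b : B), A i i ≠ 2 → eps i b ≤ 0
  phi_im : ∀ (i : I) (b : B), A i i ≠ 2 → phi i b = ⊥ ∨ 0 ≤ phi i b

/-- Finite "orthogonal" subsets of the imaginary simple roots, encoded by their
index sets: `F ∈ 𝒫(Π_im)`. -/
def PImSet (A : I → I → ℤ) (F : Finset I) : Prop :=
  (∀ i ∈ F, A i i ≠ 2) ∧ ∀ i ∈ F, ∀ j ∈ F, i ≠ j → A i j = 0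

end GKM

namespace GKM

section Formal

variable {I : Type*} (C : I → I → ℤ)

/-- The pairing between formal coroots and formal roots determined by the matrix `C`. -/
noncomputable def formalPairing : (I →₀ ℤ) →ₗ[ℤ] (I →₀ ℤ) →ₗ[ℤ] ℤ :=
  Finsupp.linearCombination ℤ fun i => Finsupp.linearCombination ℤ (C i)

/-- The `i`-th simple reflection acting on formal roots and on formal coroots. -/
noncomputable def formalRefl (i : I) :
    Module.End ℤ (I →₀ ℤ) × Module.End ℤ (I →₀ ℤ) :=
  (LinearMap.id - (formalPairing C (Finsupp.single i 1)).smulRight (Finsupp.single i 1),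
   LinearMap.id - ((formalPairing C).flip (Finsupp.single i 1)).smulRight (Finsupp.single i 1))

/-- The product of simple reflections along a word. -/
noncomputable def formalWord (l : List I) :
    Module.End ℤ (I →₀ ℤ) × Module.End ℤ (I →₀ ℤ) :=
  (l.map (formalRefl C)).prod

/-- The image of the `i`-th simple root and that of the `i`-th simple coroot are both
nonnegative. -/
def IsPosAt (g : Module.End ℤ (I →₀ ℤ) × Module.End ℤ (I →₀ ℤ)) (i : I) : Prop :=
  (∀ k, 0 ≤ g.1 (Finsupp.single i 1) k) ∧ ∀ k, 0 ≤ g.2 (Finsupp.single i 1) k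

/-- The image of the `i`-th simple root and that of the `i`-th simple coroot are both
nonpositive. -/
def IsNegAt (g : Module.End ℤ (I →₀ ℤ) × Module.End ℤ (I →₀ ℤ)) (i : I) : Prop :=
  (∀ k, g.1 (Finsupp.single i 1) k ≤ 0) ∧ ∀ k, g.2 (Finsupp.single i 1) k ≤ 0

lemma formalPairing_single_single (i j : I) :
    formalPairing C (Finsupp.single i 1) (Finsupp.single j 1) = C i j := by
  simp [formalPairing]

lemma formalPairing_single_left (i : I) (x : I →₀ ℤ) :
    formalPairing C (Finsupp.single i 1) x = ∑ k ∈ x.support, x k * C i k := by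
  simp [formalPairing, Finsupp.linearCombination_apply, Finsupp.sum]

lemma formalPairing_single_right (y : I →₀ ℤ) (j : I) :
    formalPairing C y (Finsupp.single j 1) = ∑ k ∈ y.support, y k * C k j := by
  simp [formalPairing, Finsupp.linearCombination_apply, Finsupp.sum]

lemma formalRefl_fst (i : I) (x : I →₀ ℤ) :
    (formalRefl C i).1 x =
      x - formalPairing C (Finsupp.single i 1) x • Finsupp.single i 1 := rfl

lemma formalRefl_snd (i : I) (y : I →₀ ℤ) :
    (formalRefl C i).2 y =
      y - formalPairing C y (Finsupp.single i 1) • Finsupp.single i 1 := rfl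

lemma formalWord_nil : formalWord C [] = 1 := rfl

lemma formalWord_cons (i : I) (l : List I) :
    formalWord C (i :: l) = formalRefl C i * formalWord C l := by
  simp [formalWord]

lemma formalWord_append (l l' : List I) :
    formalWord C (l ++ l') = formalWord C l * formalWord C l' := by
  simp [formalWord]

lemma formalWord_singleton (i : I) : formalWord C [i] = formalRefl C i := by
  simp [formalWord]

variable {C}

lemma formalRefl_mul_self (hC : ∀ i, C i i = 2) (i : I) :
    formalRefl C i * formalRefl C i = 1 := by
  refine Prod.ext (LinearMap.ext fun x => ?_) (LinearMap.ext fun x => ?_)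
  · change (formalRefl C i).1 ((formalRefl C i).1 x) = x
    simp only [formalRefl_fst, map_sub, map_smul, formalPairing_single_single, hC]
    module
  · change (formalRefl C i).2 ((formalRefl C i).2 x) = x
    simp only [formalRefl_snd, map_sub, map_smul, formalPairing_single_single, hC]
    module

lemma formalWord_mul_reverse (hC : ∀ i, C i i = 2) (l : List I) :
    formalWord C l * formalWord C l.reverse = 1 := by
  induction l with
  | nil => simp [formalWord]
  | cons i l ih =>
    rw [List.reverse_cons, formalWord_append, formalWord_cons, formalWord_singleton,
      mul_assoc, ← mul_assoc (formalWord C l), ih, one_mul, formalRefl_mul_self hC]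

lemma formalPairing_word (hC : ∀ i, C i i = 2) (l : List I) (y x : I →₀ ℤ) :
    formalPairing C ((formalWord C l).2 y) ((formalWord C l).1 x) = formalPairing C y x := by
  induction l with
  | nil => rfl
  | cons i l ih =>
    rw [← ih, formalWord_cons]
    change formalPairing C ((formalRefl C i).2 ((formalWord C l).2 y))
      ((formalRefl C i).1 ((formalWord C l).1 x)) = _
    simp only [formalRefl_fst, formalRefl_snd, map_sub, map_smul, LinearMap.sub_apply,
      LinearMap.smul_apply, formalPairing_single_single, hC, smul_eq_mul]
    ring

/-- The only positive real root made negative by a simple reflection is the simple root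
itself. -/
lemma eq_single_of_isPosAt_of_isNegAt (hC : ∀ i, C i i = 2) {l : List I} {i j : I}
    (hpos : IsPosAt (formalWord C l) i) (hneg : IsNegAt (formalWord C (j :: l)) i) :
    (formalWord C l).1 (Finsupp.single i 1) = Finsupp.single j 1 ∧
      (formalWord C l).2 (Finsupp.single i 1) = Finsupp.single j 1 := by
  have h2 := formalPairing_word hC l (Finsupp.single i 1) (Finsupp.single i 1)
  rw [formalPairing_single_single, hC] at h2
  rw [formalWord_cons] at hneg
  obtain ⟨hp1, hp2⟩ := hpos
  obtain ⟨hn1, hn2⟩ := hneg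
  change ∀ k, (formalRefl C j).1 ((formalWord C l).1 (Finsupp.single i 1)) k ≤ 0 at hn1
  change ∀ k, (formalRefl C j).2 ((formalWord C l).2 (Finsupp.single i 1)) k ≤ 0 at hn2
  generalize (formalWord C l).1 (Finsupp.single i 1) = x at *
  generalize (formalWord C l).2 (Finsupp.single i 1) = y at *
  have hx : x = x j • Finsupp.single j 1 := by
    ext k
    rcases eq_or_ne j k with rfl | hk
    · simp
    · have := hn1 k
      simp [formalRefl_fst, hk] at this ⊢
      exact le_antisymm this (hp1 k)
  have hy : y = y j • Finsupp.single j 1 := by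
    ext k
    rcases eq_or_ne j k with rfl | hk
    · simp
    · have := hn2 k
      simp [formalRefl_snd, hk] at this ⊢
      exact le_antisymm this (hp2 k)
  rw [hx, hy] at h2
  simp only [map_smul, LinearMap.smul_apply, formalPairing_single_single, hC, smul_eq_mul] at h2
  have hmul : y j * x j = 1 := by linarith
  have hy1 : y j = 1 := Int.eq_one_of_mul_eq_one_right (hp2 j) hmul
  have hx1 : x j = 1 := by simpa [hy1] using hmul
  exact ⟨by rw [hx, hx1, one_smul], by rw [hy, hy1, one_smul]⟩

lemma formalWord_mul_formalRefl (hC : ∀ i, C i i = 2) {l : List I} {i j : I}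
    (h1 : (formalWord C l).1 (Finsupp.single i 1) = Finsupp.single j 1)
    (h2 : (formalWord C l).2 (Finsupp.single i 1) = Finsupp.single j 1) :
    formalWord C l * formalRefl C i = formalRefl C j * formalWord C l := by
  refine Prod.ext (LinearMap.ext fun x => ?_) (LinearMap.ext fun y => ?_)
  · change (formalWord C l).1 ((formalRefl C i).1 x) =
      (formalRefl C j).1 ((formalWord C l).1 x)
    rw [formalRefl_fst, formalRefl_fst, map_sub, map_smul, h1, ← h2, formalPairing_word hC]
  · change (formalWord C l).2 ((formalRefl C i).2 y) =
      (formalRefl C j).2 ((formalWord C l).2 y)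
    rw [formalRefl_snd, formalRefl_snd, map_sub, map_smul, h2, ← h1, formalPairing_word hC]

lemma formalWord_conj_fst (hC : ∀ i, C i i = 2) (l : List I) (i : I) (x : I →₀ ℤ) :
    (formalWord C (l ++ i :: l.reverse)).1 x =
      x - formalPairing C ((formalWord C l).2 (Finsupp.single i 1)) x •
        (formalWord C l).1 (Finsupp.single i 1) := by
  have hinv : (formalWord C l).1 ((formalWord C l.reverse).1 x) = x :=
    LinearMap.congr_fun (congrArg Prod.fst (formalWord_mul_reverse hC l)) x
  rw [formalWord_append, formalWord_cons]
  change (formalWord C l).1 ((formalRefl C i).1 ((formalWord C l.reverse).1 x)) = _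
  rw [formalRefl_fst, map_sub, map_smul, hinv, ← formalPairing_word hC l, hinv]

lemma formalWord_conj_snd (hC : ∀ i, C i i = 2) (l : List I) (i : I) (y : I →₀ ℤ) :
    (formalWord C (l ++ i :: l.reverse)).2 y =
      y - formalPairing C y ((formalWord C l).1 (Finsupp.single i 1)) •
        (formalWord C l).2 (Finsupp.single i 1) := by
  have hinv : (formalWord C l).2 ((formalWord C l.reverse).2 y) = y :=
    LinearMap.congr_fun (congrArg Prod.snd (formalWord_mul_reverse hC l)) y
  rw [formalWord_append, formalWord_cons]
  change (formalWord C l).2 ((formalRefl C i).2 ((formalWord C l.reverse).2 y)) = _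
  rw [formalRefl_snd, map_sub, map_smul, hinv, ← formalPairing_word hC l, hinv]

/-- Deletion in the Weyl group, for a word all of whose suffixes send the `t`-th simple root
to a positive or a negative root. -/
lemma exists_shorter_of_isNegAt (hC : ∀ i, C i i = 2) (t : I) (l : List I)
    (hcoh : ∀ l' : List I, l'.length ≤ l.length →
      IsPosAt (formalWord C l') t ∨ IsNegAt (formalWord C l') t)
    (hneg : IsNegAt (formalWord C l) t) :
    ∃ l' : List I, l'.length < l.length ∧
      formalWord C l = formalWord C l' * formalRefl C t := by
  induction l with
  | nil =>
    have := hneg.1 t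
    simp [formalWord] at this
  | cons j l ih =>
    rcases hcoh l (by simp) with hp | hn
    · obtain ⟨h1, h2⟩ := eq_single_of_isPosAt_of_isNegAt hC hp hneg
      exact ⟨l, by simp, by rw [formalWord_cons, formalWord_mul_formalRefl hC h1 h2]⟩
    · obtain ⟨l', hl', h⟩ := ih (fun l' h => hcoh l' (h.trans (by simp))) hn
      exact ⟨j :: l', by simpa using hl', by rw [formalWord_cons, h, formalWord_cons, mul_assoc]⟩

/-- A rank two orbit of a simple root preserves an integral quadratic form. -/
lemma rank_two_orbit (hC : ∀ i, C i i = 2) (hzero : ∀ i j, C i j = 0 ↔ C j i = 0)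
    {s t : I} (u : List I) (hu : ∀ m ∈ u, m = s ∨ m = t) :
    ∃ p q q' : ℤ,
      (formalWord C u).1 (Finsupp.single s 1) =
        p • Finsupp.single s 1 + q • Finsupp.single t 1 ∧
      (formalWord C u).2 (Finsupp.single s 1) =
        p • Finsupp.single s 1 + q' • Finsupp.single t 1 ∧
      C t s * q' = C s t * q ∧
      C t s * p ^ 2 + C s t * C t s * (p * q) + C s t * q ^ 2 = C t s ∧
      (C s t = 0 → q = 0 ∧ q' = 0 ∧ p ^ 2 = 1) := by
  induction u with
  | nil => exact ⟨1, 0, 0, by simp [formalWord]⟩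
  | cons j u ih =>
    obtain ⟨p, q, q', h1, h2, h3, h4, h5⟩ := ih fun m hm => hu m (by simp [hm])
    have e1 : (formalWord C (j :: u)).1 (Finsupp.single s 1) =
        (formalRefl C j).1 ((formalWord C u).1 (Finsupp.single s 1)) := by
      rw [formalWord_cons]; rfl
    have e2 : (formalWord C (j :: u)).2 (Finsupp.single s 1) =
        (formalRefl C j).2 ((formalWord C u).2 (Finsupp.single s 1)) := by
      rw [formalWord_cons]; rfl
    rcases hu j (by simp) with rfl | rfl
    · refine ⟨-p - C j t * q, q, q', ?_, ?_, h3, by linear_combination h4, fun h => ?_⟩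
      · rw [e1, h1, formalRefl_fst]
        simp only [map_add, map_smul, formalPairing_single_single, hC, smul_eq_mul]
        module
      · rw [e2, h2, formalRefl_snd]
        simp only [map_add, map_smul, LinearMap.add_apply, LinearMap.smul_apply,
          formalPairing_single_single, hC, smul_eq_mul]
        rw [← h3]
        module
      · obtain ⟨hq, hq', hp⟩ := h5 h
        exact ⟨hq, hq', by rw [h]; linear_combination hp⟩
    · refine ⟨p, -q - C j s * p, -q' - C s j * p, ?_, ?_, by linear_combination -h3,
        by linear_combination h4, fun h => ?_⟩
      · rw [e1, h1, formalRefl_fst]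
        simp only [map_add, map_smul, formalPairing_single_single, hC, smul_eq_mul]
        module
      · rw [e2, h2, formalRefl_snd]
        simp only [map_add, map_smul, LinearMap.add_apply, LinearMap.smul_apply,
          formalPairing_single_single, hC, smul_eq_mul]
        module
      · obtain ⟨hq, hq', hp⟩ := h5 h
        exact ⟨by simp [hq, (hzero _ _).1 h], by simp [hq', h], hp⟩

lemma rank_two_signs {a b p q q' : ℤ} (ha : a ≤ 0) (hb : b ≤ 0) (hab : a = 0 ↔ b = 0)
    (h3 : b * q' = a * q) (h4 : b * p ^ 2 + a * b * (p * q) + a * q ^ 2 = b)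
    (h5 : a = 0 → q = 0 ∧ q' = 0 ∧ p ^ 2 = 1) :
    (0 ≤ p ∧ 0 ≤ q ∧ 0 ≤ q') ∨ (p ≤ 0 ∧ q ≤ 0 ∧ q' ≤ 0) := by
  by_cases h : a = 0
  · obtain ⟨rfl, rfl, -⟩ := h5 h
    rcases le_total 0 p with hp | hp <;> simp [hp]
  have ha' : a < 0 := lt_of_le_of_ne ha h
  have hb' : b < 0 := lt_of_le_of_ne hb fun hb0 => h (hab.2 hb0)
  have hq_nonneg : 0 ≤ q → 0 ≤ q' := fun hq => by
    by_contra! hq'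
    nlinarith [mul_pos_of_neg_of_neg hb' hq', mul_nonneg (neg_nonneg.2 ha) hq]
  have hq_nonpos : q ≤ 0 → q' ≤ 0 := fun hq => by
    by_contra! hq'
    nlinarith [mul_neg_of_neg_of_pos hb' hq', mul_nonneg_of_nonpos_of_nonpos ha hq]
  have hpq : 0 ≤ p * q := by
    by_contra! hneg
    have hp : 1 ≤ p ^ 2 := by
      have : p ≠ 0 := by rintro rfl; simp at hneg
      have := sq_pos_of_ne_zero this
      omega
    have hq : 1 ≤ q ^ 2 := by
      have : q ≠ 0 := by rintro rfl; simp at hneg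
      have := sq_pos_of_ne_zero this
      omega
    have k1 := mul_neg_of_pos_of_neg (mul_pos_of_neg_of_neg ha' hb') hneg
    nlinarith [mul_nonneg (neg_nonneg.2 ha) (sub_nonneg.2 hq),
      mul_nonneg (neg_nonneg.2 hb) (sub_nonneg.2 hp)]
  rcases lt_trichotomy p 0 with hp | rfl | hp
  · have : q ≤ 0 := by by_contra! hq; nlinarith
    exact Or.inr ⟨hp.le, this, hq_nonpos this⟩
  · rcases le_total 0 q with hq | hq
    · exact Or.inl ⟨le_rfl, hq, hq_nonneg hq⟩
    · exact Or.inr ⟨le_rfl, hq, hq_nonpos hq⟩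
  · have : 0 ≤ q := by by_contra! hq; nlinarith
    exact Or.inl ⟨hp.le, this, hq_nonneg this⟩

/-- Every element of the Weyl group can be written as `v' * u` with `u` in the rank two
parabolic subgroup on `s, t` and `v'` sending both simple roots to positive roots. -/
lemma exists_rank_two_coset (hC : ∀ i, C i i = 2) (s t : I) (v : List I)
    (hcoh : ∀ l' : List I, l'.length ≤ v.length → ∀ i,
      IsPosAt (formalWord C l') i ∨ IsNegAt (formalWord C l') i) :
    ∃ v' u : List I, (∀ m ∈ u, m = s ∨ m = t) ∧
      formalWord C v = formalWord C v' * formalWord C u ∧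
      IsPosAt (formalWord C v') s ∧ IsPosAt (formalWord C v') t := by
  induction hn : v.length using Nat.strong_induction_on generalizing v with
  | _ n ih =>
    subst hn
    have step : ∀ r, (r = s ∨ r = t) → IsNegAt (formalWord C v) r →
        ∃ v' u : List I, (∀ m ∈ u, m = s ∨ m = t) ∧
          formalWord C v = formalWord C v' * formalWord C u ∧
          IsPosAt (formalWord C v') s ∧ IsPosAt (formalWord C v') t := by
      intro r hr hneg
      obtain ⟨v₁, hlen, hv⟩ :=
        exists_shorter_of_isNegAt hC r v (fun l' h => hcoh l' h r) hneg
      obtain ⟨v', u, hu, hv', hps, hpt⟩ :=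
        ih _ hlen v₁ (fun l' h => hcoh l' (h.trans hlen.le)) rfl
      refine ⟨v', u ++ [r], ?_, ?_, hps, hpt⟩
      · intro m hm
        rcases List.mem_append.1 hm with hm | hm
        · exact hu m hm
        · rw [List.mem_singleton.1 hm]; exact hr
      · rw [hv, hv', formalWord_append, formalWord_singleton, mul_assoc]
    rcases hcoh v le_rfl s with hs | hs
    · rcases hcoh v le_rfl t with ht | ht
      · exact ⟨v, [], by simp, by simp [formalWord_nil], hs, ht⟩
      · exact step t (Or.inr rfl) ht
    · exact step s (Or.inl rfl) hs

/-- Real roots and their coroots are simultaneously positive or simultaneously negative. -/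
theorem isPosAt_or_isNegAt (hC : ∀ i, C i i = 2) (hoff : ∀ i j, i ≠ j → C i j ≤ 0)
    (hzero : ∀ i j, C i j = 0 ↔ C j i = 0) (w : List I) (s : I) :
    IsPosAt (formalWord C w) s ∨ IsNegAt (formalWord C w) s := by
  induction hn : w.length using Nat.strong_induction_on generalizing w s with
  | _ n ih =>
    subst hn
    rcases List.eq_nil_or_concat w with rfl | ⟨v, t, rfl⟩
    · refine Or.inl ⟨fun k => ?_, fun k => ?_⟩ <;>
        exact (Finsupp.single_nonneg.2 (zero_le_one' ℤ)) k
    have hcoh : ∀ l' : List I, l'.length ≤ v.length → ∀ i,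
        IsPosAt (formalWord C l') i ∨ IsNegAt (formalWord C l') i :=
      fun l' h i => ih l'.length (by simpa using Nat.lt_succ_of_le h) l' i rfl
    obtain ⟨v', u, hu, hv, hps, hpt⟩ := exists_rank_two_coset hC s t v hcoh
    have hw : formalWord C (v ++ [t]) = formalWord C v' * formalWord C (u ++ [t]) := by
      rw [formalWord_append, hv, formalWord_append, mul_assoc]
    rcases eq_or_ne s t with rfl | hst
    · have hfst : (formalWord C (v ++ [s])).1 (Finsupp.single s 1) =
          -(formalWord C v).1 (Finsupp.single s 1) := by
        rw [formalWord_append, formalWord_singleton]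
        change (formalWord C v).1 ((formalRefl C s).1 _) = _
        rw [formalRefl_fst, formalPairing_single_single, hC, map_sub, map_smul]
        module
      have hsnd : (formalWord C (v ++ [s])).2 (Finsupp.single s 1) =
          -(formalWord C v).2 (Finsupp.single s 1) := by
        rw [formalWord_append, formalWord_singleton]
        change (formalWord C v).2 ((formalRefl C s).2 _) = _
        rw [formalRefl_snd, formalPairing_single_single, hC, map_sub, map_smul]
        module
      unfold IsPosAt IsNegAt
      rw [List.concat_eq_append, hfst, hsnd]
      rcases hcoh v le_rfl s with h | h
      · exact Or.inr ⟨fun k => by simpa using h.1 k, fun k => by simpa using h.2 k⟩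
      · exact Or.inl ⟨fun k => by simpa using h.1 k, fun k => by simpa using h.2 k⟩
    · obtain ⟨p, q, q', h1, h2, h3, h4, h5⟩ :=
        rank_two_orbit hC hzero (s := s) (t := t) (u ++ [t]) (by
          intro m hm
          rcases List.mem_append.1 hm with hm | hm
          · exact hu m hm
          · exact Or.inr (List.mem_singleton.1 hm))
      have hfst : (formalWord C (v ++ [t])).1 (Finsupp.single s 1) =
          p • (formalWord C v').1 (Finsupp.single s 1) +
            q • (formalWord C v').1 (Finsupp.single t 1) := by
        rw [hw, ← map_smul, ← map_smul, ← map_add, ← h1]; rfl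
      have hsnd : (formalWord C (v ++ [t])).2 (Finsupp.single s 1) =
          p • (formalWord C v').2 (Finsupp.single s 1) +
            q' • (formalWord C v').2 (Finsupp.single t 1) := by
        rw [hw, ← map_smul, ← map_smul, ← map_add, ← h2]; rfl
      unfold IsPosAt IsNegAt
      rw [List.concat_eq_append, hfst, hsnd]
      simp only [Finsupp.add_apply, Finsupp.smul_apply, smul_eq_mul]
      rcases rank_two_signs (hoff s t hst) (hoff t s hst.symm) (hzero s t) h3 h4 h5 with
        ⟨hp, hq, hq'⟩ | ⟨hp, hq, hq'⟩
      · exact Or.inl ⟨fun k => add_nonneg (mul_nonneg hp (hps.1 k)) (mul_nonneg hq (hpt.1 k)),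
          fun k => add_nonneg (mul_nonneg hp (hps.2 k)) (mul_nonneg hq' (hpt.2 k))⟩
      · exact Or.inr ⟨fun k => add_nonpos (mul_nonpos_of_nonpos_of_nonneg hp (hps.1 k))
            (mul_nonpos_of_nonpos_of_nonneg hq (hpt.1 k)),
          fun k => add_nonpos (mul_nonpos_of_nonpos_of_nonneg hp (hps.2 k))
            (mul_nonpos_of_nonpos_of_nonneg hq' (hpt.2 k))⟩

/-- The vanishing of the pairing of a real root with a simple root is symmetric. -/
lemma formalPairing_eq_zero_comm (hC : ∀ i, C i i = 2) (hoff : ∀ i j, i ≠ j → C i j ≤ 0)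
    (hzero : ∀ i j, C i j = 0 ↔ C j i = 0) (l : List I) (i j : I) :
    formalPairing C (Finsupp.single j 1) ((formalWord C l).1 (Finsupp.single i 1)) = 0 ↔
      formalPairing C ((formalWord C l).2 (Finsupp.single i 1)) (Finsupp.single j 1) = 0 := by
  have h2 := formalPairing_word hC l (Finsupp.single i 1) (Finsupp.single i 1)
  rw [formalPairing_single_single, hC] at h2
  have hr1 := formalWord_conj_fst hC l i (Finsupp.single j 1)
  have hr2 := formalWord_conj_snd hC l i (Finsupp.single j 1)
  set r := l ++ i :: l.reverse
  have c0 := isPosAt_or_isNegAt hC hoff hzero r j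
  have c1 := isPosAt_or_isNegAt hC hoff hzero (j :: r) j
  have e1 : (formalWord C (j :: r)).1 (Finsupp.single j 1) =
      (formalRefl C j).1 ((formalWord C r).1 (Finsupp.single j 1)) := by
    rw [formalWord_cons]; rfl
  have e2 : (formalWord C (j :: r)).2 (Finsupp.single j 1) =
      (formalRefl C j).2 ((formalWord C r).2 (Finsupp.single j 1)) := by
    rw [formalWord_cons]; rfl
  generalize (formalWord C l).1 (Finsupp.single i 1) = x at *
  generalize (formalWord C l).2 (Finsupp.single i 1) = y at *
  constructor
  · intro h
    rw [h, zero_smul, sub_zero] at hr2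
    have hp : IsPosAt (formalWord C r) j := by
      refine c0.resolve_right fun hn => ?_
      have := hn.2 j
      simp [hr2] at this
    have hn : IsNegAt (formalWord C (j :: r)) j := by
      refine c1.resolve_left fun hp => ?_
      have := hp.2 j
      simp [e2, hr2, formalRefl_snd, formalPairing_single_single, hC] at this
    have key := (eq_single_of_isPosAt_of_isNegAt hC hp hn).1
    rw [hr1, sub_eq_self] at key
    have := congrArg (formalPairing C y) key
    rw [map_smul, h2, map_zero, smul_eq_mul] at this
    omega
  · intro h
    rw [h, zero_smul, sub_zero] at hr1
    have hp : IsPosAt (formalWord C r) j := by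
      refine c0.resolve_right fun hn => ?_
      have := hn.1 j
      simp [hr1] at this
    have hn : IsNegAt (formalWord C (j :: r)) j := by
      refine c1.resolve_left fun hp => ?_
      have := hp.1 j
      simp [e1, hr1, formalRefl_fst, formalPairing_single_single, hC] at this
    have key := (eq_single_of_isPosAt_of_isNegAt hC hp hn).2
    rw [hr2, sub_eq_self] at key
    have := congrArg (fun z => formalPairing C z x) key
    simp only [map_smul, LinearMap.smul_apply, h2, map_zero, smul_eq_mul,
      LinearMap.zero_apply] at this
    omega

lemma formalWord_apply_eq_zero {l : List I} {i j : I} (hij : i ≠ j) (hj : j ∉ l) :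
    (formalWord C l).1 (Finsupp.single i 1) j = 0 ∧
      (formalWord C l).2 (Finsupp.single i 1) j = 0 := by
  induction l with
  | nil => simp [formalWord_nil, hij]
  | cons k l ih =>
    rw [List.mem_cons, not_or] at hj
    obtain ⟨h1, h2⟩ := ih hj.2
    rw [formalWord_cons]
    change (formalRefl C k).1 ((formalWord C l).1 (Finsupp.single i 1)) j = 0 ∧
      (formalRefl C k).2 ((formalWord C l).2 (Finsupp.single i 1)) j = 0
    simp [formalRefl_fst, formalRefl_snd, h1, h2, Ne.symm hj.1]

end Formal

section Realization

variable {I V : Type*} [AddCommGroup V] [Module ℚ V]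

open Classical in
/-- The generalized Cartan matrix obtained by making every index real. -/
noncomputable def realMatrix (A : I → I → ℤ) (i j : I) : ℤ := if i = j then 2 else A i j

lemma realMatrix_self (A : I → I → ℤ) (i : I) : realMatrix A i i = 2 := by simp [realMatrix]

lemma realMatrix_of_ne (A : I → I → ℤ) {i j : I} (h : i ≠ j) : realMatrix A i j = A i j := by
  simp [realMatrix, h]

lemma realMatrix_nonpos {A : I → I → ℤ} (hoff : ∀ i j, i ≠ j → A i j ≤ 0) (i j : I)
    (h : i ≠ j) : realMatrix A i j ≤ 0 := by
  rw [realMatrix_of_ne A h]; exact hoff i j h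

lemma realMatrix_eq_zero_comm {A : I → I → ℤ} (hzero : ∀ i j, A i j = 0 ↔ A j i = 0)
    (i j : I) : realMatrix A i j = 0 ↔ realMatrix A j i = 0 := by
  rcases eq_or_ne i j with rfl | h
  · rfl
  · rw [realMatrix_of_ne A h, realMatrix_of_ne A h.symm, hzero]

variable {A : I → I → ℤ} {α : I → V} {coroot : I → (V →ₗ[ℚ] ℚ)}

lemma srefl_apply (i : I) (x : V) : srefl α coroot i x = x - coroot i x • α i := rfl

lemma reflRoot_apply (β : V) (βv : V →ₗ[ℚ] ℚ) (x : V) : reflRoot β βv x = x - βv x • β := rfl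

lemma coroot_linearCombination (hpair : ∀ i j, coroot i (α j) = (A i j : ℚ)) {j : I}
    {x : I →₀ ℤ} (h : A j j = 2 ∨ x j = 0) :
    coroot j (Finsupp.linearCombination ℤ α x) =
      (formalPairing (realMatrix A) (Finsupp.single j 1) x : ℚ) := by
  simp only [formalPairing_single_left,
    Finsupp.linearCombination_apply, Finsupp.sum, map_sum, map_zsmul, hpair, zsmul_eq_mul,
    Int.cast_sum, Int.cast_mul]
  refine Finset.sum_congr rfl fun k hk => ?_
  rcases eq_or_ne j k with rfl | hjk
  · rw [realMatrix_self, h.resolve_right (Finsupp.mem_support_iff.1 hk)]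
  · rw [realMatrix_of_ne A hjk]

lemma linearCombination_coroot (hpair : ∀ i j, coroot i (α j) = (A i j : ℚ)) {j : I}
    {y : I →₀ ℤ} (h : A j j = 2 ∨ y j = 0) :
    Finsupp.linearCombination ℤ coroot y (α j) =
      (formalPairing (realMatrix A) y (Finsupp.single j 1) : ℚ) := by
  simp only [formalPairing_single_right, Finsupp.linearCombination_apply, Finsupp.sum,
    LinearMap.sum_apply, LinearMap.smul_apply, hpair, zsmul_eq_mul, Int.cast_sum, Int.cast_mul]
  refine Finset.sum_congr rfl fun k hk => ?_
  rcases eq_or_ne k j with rfl | hjk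
  · simp [realMatrix_self, h.resolve_right (Finsupp.mem_support_iff.1 hk)]
  · simp [realMatrix_of_ne A hjk]

lemma linearCombination_formalRefl_fst (hpair : ∀ i j, coroot i (α j) = (A i j : ℚ)) {j : I}
    (hj : A j j = 2) (x : I →₀ ℤ) :
    Finsupp.linearCombination ℤ α ((formalRefl (realMatrix A) j).1 x) =
      srefl α coroot j (Finsupp.linearCombination ℤ α x) := by
  rw [srefl_apply, coroot_linearCombination hpair (Or.inl hj), formalRefl_fst, map_sub, map_smul,
    Finsupp.linearCombination_single, one_smul, Int.cast_smul_eq_zsmul]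

lemma linearCombination_formalRefl_snd (hpair : ∀ i j, coroot i (α j) = (A i j : ℚ)) {j : I}
    (hj : A j j = 2) (y : I →₀ ℤ) (v : V) :
    Finsupp.linearCombination ℤ coroot ((formalRefl (realMatrix A) j).2 y) v =
      Finsupp.linearCombination ℤ coroot y (srefl α coroot j v) := by
  rw [srefl_apply, formalRefl_snd, map_sub, map_sub, map_smul, map_smul,
    linearCombination_coroot hpair (Or.inl hj), Finsupp.linearCombination_single, one_smul,
    LinearMap.sub_apply, LinearMap.smul_apply, zsmul_eq_mul, smul_eq_mul, mul_comm]

lemma srefl_srefl (hpair : ∀ i j, coroot i (α j) = (A i j : ℚ)) {j : I} (hj : A j j = 2)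
    (v : V) : srefl α coroot j (srefl α coroot j v) = v := by
  simp only [srefl_apply, map_sub, map_smul, hpair, hj]
  push_cast
  module

/-- Exchange condition for `T`: reflecting along a positive real root whose coroot is negative
on `τ λ` shortens the word of `τ`. -/
lemma exists_shorter_reflRoot_mul (hpair : ∀ i j, coroot i (α j) = (A i j : ℚ))
    (hdiag : ∀ i, A i i = 2 ∨ A i i ≤ 0) (hoff : ∀ i j, i ≠ j → A i j ≤ 0)
    (hzero : ∀ i j, A i j = 0 ↔ A j i = 0) {lam : V} (hlam : ∀ i, 0 ≤ coroot i lam)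
    (l : List I)
    (himag : ∀ l' : List I, l'.length < l.length → ∀ j, A j j ≤ 0 →
      0 ≤ coroot j ((l'.map (srefl α coroot)).prod lam))
    (w : List I) (i : I) (hw : ∀ m ∈ w, A m m = 2) (hi : A i i = 2)
    (hpos : IsPosAt (formalWord (realMatrix A) w) i)
    (hneg : Finsupp.linearCombination ℤ coroot
      ((formalWord (realMatrix A) w).2 (Finsupp.single i 1))
      ((l.map (srefl α coroot)).prod lam) < 0) :
    ∃ l' : List I, l'.length < l.length ∧
      reflRoot (Finsupp.linearCombination ℤ α
          ((formalWord (realMatrix A) w).1 (Finsupp.single i 1)))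
        (Finsupp.linearCombination ℤ coroot
          ((formalWord (realMatrix A) w).2 (Finsupp.single i 1))) *
        (l.map (srefl α coroot)).prod = (l'.map (srefl α coroot)).prod := by
  have hC := realMatrix_self A
  have hoffC := realMatrix_nonpos hoff
  have hzeroC := realMatrix_eq_zero_comm hzero
  induction l generalizing w with
  | nil =>
    refine absurd hneg (not_lt.2 ?_)
    simp only [List.map_nil, List.prod_nil, Module.End.one_apply,
      Finsupp.linearCombination_apply, Finsupp.sum, LinearMap.sum_apply, LinearMap.smul_apply]
    exact Finset.sum_nonneg fun k _ => zsmul_nonneg (hlam k) (hpos.2 k)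
  | cons j l ih =>
    have himag' : ∀ l' : List I, l'.length < l.length → ∀ j, A j j ≤ 0 →
        0 ≤ coroot j ((l'.map (srefl α coroot)).prod lam) :=
      fun l' h => himag l' (h.trans (by simp))
    simp only [List.map_cons, List.prod_cons, Module.End.mul_apply] at hneg ⊢
    rcases hdiag j with hj | hj
    · rcases isPosAt_or_isNegAt hC hoffC hzeroC (j :: w) i with hp | hn
      · have e1 : Finsupp.linearCombination ℤ α
            ((formalWord (realMatrix A) (j :: w)).1 (Finsupp.single i 1)) =
            srefl α coroot j (Finsupp.linearCombination ℤ α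
              ((formalWord (realMatrix A) w).1 (Finsupp.single i 1))) := by
          rw [← linearCombination_formalRefl_fst hpair hj, formalWord_cons]; rfl
        have e2 : ∀ v, Finsupp.linearCombination ℤ coroot
            ((formalWord (realMatrix A) (j :: w)).2 (Finsupp.single i 1)) v =
            Finsupp.linearCombination ℤ coroot
              ((formalWord (realMatrix A) w).2 (Finsupp.single i 1)) (srefl α coroot j v) := by
          intro v
          rw [← linearCombination_formalRefl_snd hpair hj, formalWord_cons]; rfl
        obtain ⟨l', hlen, hl'⟩ := ih himag' (j :: w) (by
          intro m hm
          rcases List.mem_cons.1 hm with rfl | hm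
          · exact hj
          · exact hw m hm) hp (by rw [e2]; exact hneg)
        refine ⟨j :: l', by simpa using hlen, ?_⟩
        rw [List.map_cons, List.prod_cons, ← hl', ← mul_assoc, ← mul_assoc]
        congr 1
        ext v
        simp only [Module.End.mul_apply, reflRoot_apply, e1, e2, map_sub, map_smul,
          srefl_srefl hpair hj]
      · obtain ⟨h1, h2⟩ := eq_single_of_isPosAt_of_isNegAt hC hpos hn
        refine ⟨l, by simp, ?_⟩
        ext v
        simp only [h1, h2, Finsupp.linearCombination_single, one_smul, Module.End.mul_apply]
        exact srefl_srefl hpair hj _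
    · have hij : i ≠ j := by rintro rfl; omega
      have hjw : j ∉ w := fun h => by have := hw j h; omega
      obtain ⟨hx0, hy0⟩ := formalWord_apply_eq_zero (C := realMatrix A) hij hjw
      have hcomm := formalPairing_eq_zero_comm hC hoffC hzeroC w i j
      have hm := coroot_linearCombination (α := α) hpair (j := j) (Or.inr hx0)
      have hn := linearCombination_coroot (coroot := coroot) hpair (j := j) (Or.inr hy0)
      have hnonpos : formalPairing (realMatrix A) (Finsupp.single j 1)
          ((formalWord (realMatrix A) w).1 (Finsupp.single i 1)) ≤ 0 := by
        rw [formalPairing_single_left]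
        refine Finset.sum_nonpos fun k hk => ?_
        refine mul_nonpos_of_nonneg_of_nonpos (hpos.1 k) (hoffC j k ?_)
        rintro rfl
        exact Finsupp.mem_support_iff.1 hk hx0
      have hnonpos' : formalPairing (realMatrix A)
          ((formalWord (realMatrix A) w).2 (Finsupp.single i 1)) (Finsupp.single j 1) ≤ 0 := by
        rw [formalPairing_single_right]
        refine Finset.sum_nonpos fun k hk => ?_
        refine mul_nonpos_of_nonneg_of_nonpos (hpos.2 k) (hoffC k j ?_)
        rintro rfl
        exact Finsupp.mem_support_iff.1 hk hy0
      have ih' := ih himag' w hw hpos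
      generalize formalPairing (realMatrix A) (Finsupp.single j 1)
        ((formalWord (realMatrix A) w).1 (Finsupp.single i 1)) = m at *
      generalize formalPairing (realMatrix A)
        ((formalWord (realMatrix A) w).2 (Finsupp.single i 1)) (Finsupp.single j 1) = n at *
      generalize Finsupp.linearCombination ℤ coroot
        ((formalWord (realMatrix A) w).2 (Finsupp.single i 1)) = βv at *
      generalize Finsupp.linearCombination ℤ α
        ((formalWord (realMatrix A) w).1 (Finsupp.single i 1)) = β at *
      rw [srefl_apply, map_sub, map_smul, hn, smul_eq_mul] at hneg
      by_cases hn0 : n = 0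
      · have hm0 := hcomm.2 hn0
        obtain ⟨l', hlen, hl'⟩ := ih' (by simpa [hn0] using hneg)
        refine ⟨j :: l', by simpa using hlen, ?_⟩
        rw [List.map_cons, List.prod_cons, ← hl', ← mul_assoc, ← mul_assoc]
        congr 1
        ext v
        simp only [Module.End.mul_apply, reflRoot_apply, srefl_apply, map_sub, map_smul, hm, hn,
          hn0, hm0, Int.cast_zero, zero_smul, sub_zero]
        abel
      · have hm1 : (m : ℚ) ≤ -1 := by
          have : m ≤ -1 := by have := mt hcomm.1 hn0; omega
          exact_mod_cast this
        have hn1 : (n : ℚ) ≤ -1 := by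
          have : n ≤ -1 := by omega
          exact_mod_cast this
        exfalso
        have hcj := himag l (by simp) j hj
        rcases lt_or_ge (βv ((l.map (srefl α coroot)).prod lam)) 0 with hlt | hge
        · obtain ⟨l', hlen, hl'⟩ := ih' hlt
          have h := himag' l' hlen j hj
          rw [← hl', Module.End.mul_apply, reflRoot_apply, map_sub, map_smul, hm,
            smul_eq_mul] at h
          nlinarith
        · nlinarith

/-- Each `τ λ` lies below the dominant `λ`, and `τ` is a product of simple reflections fixing
`λ` as soon as `τ λ = λ`. -/
theorem sub_word_apply_mem_cone (hind : LinearIndependent ℚ α)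
    (hpair : ∀ i j, coroot i (α j) = (A i j : ℚ))
    (hdiag : ∀ i, A i i = 2 ∨ A i i ≤ 0) (hoff : ∀ i j, i ≠ j → A i j ≤ 0)
    (hzero : ∀ i j, A i j = 0 ↔ A j i = 0) {lam : V} (hlam : ∀ i, 0 ≤ coroot i lam)
    (l : List I) :
    (∃ c : I →₀ ℚ, (∀ k, 0 ≤ c k) ∧
      lam - (l.map (srefl α coroot)).prod lam = Finsupp.linearCombination ℚ α c) ∧
    ((l.map (srefl α coroot)).prod lam = lam → (l.map (srefl α coroot)).prod ∈
      Submonoid.closure (srefl α coroot '' {i | coroot i lam = 0})) := by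
  induction hlen : l.length using Nat.strong_induction_on generalizing l with
  | _ n ih =>
    subst hlen
    have himag : ∀ l' : List I, l'.length < l.length → ∀ j, A j j ≤ 0 →
        0 ≤ coroot j ((l'.map (srefl α coroot)).prod lam) := by
      intro l' h j hj
      obtain ⟨⟨c, hc, hlc⟩, -⟩ := ih _ h l' rfl
      rw [← sub_sub_cancel lam ((l'.map (srefl α coroot)).prod lam), hlc, map_sub]
      have : coroot j (Finsupp.linearCombination ℚ α c) ≤ 0 := by
        simp only [Finsupp.linearCombination_apply, Finsupp.sum, map_sum, map_smul, hpair,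
          smul_eq_mul]
        refine Finset.sum_nonpos fun k _ => mul_nonpos_of_nonneg_of_nonpos (hc k) ?_
        rcases eq_or_ne j k with rfl | hjk
        · exact_mod_cast hj
        · exact_mod_cast hoff j k hjk
      linarith [hlam j]
    match l with
    | [] => exact ⟨⟨0, by simp, by simp⟩, fun _ => one_mem _⟩
    | i :: l =>
      rcases lt_or_ge (coroot i ((l.map (srefl α coroot)).prod lam)) 0 with hlt | hge
      · have hi : A i i = 2 := (hdiag i).resolve_right fun h =>
          absurd (himag l (by simp) i h) (not_le.2 hlt)
        obtain ⟨l', hl', h⟩ := exists_shorter_reflRoot_mul hpair hdiag hoff hzero hlam l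
          (fun l' h => himag l' (h.trans (by simp))) [] i (by simp) hi
          ⟨fun k => (Finsupp.single_nonneg.2 (zero_le_one' ℤ)) k,
            fun k => (Finsupp.single_nonneg.2 (zero_le_one' ℤ)) k⟩
          (by simpa [formalWord_nil] using hlt)
        have hprod : ((i :: l).map (srefl α coroot)).prod = (l'.map (srefl α coroot)).prod := by
          rw [← h, List.map_cons, List.prod_cons]
          simp [formalWord_nil, reflRoot, srefl]
        rw [hprod]
        exact ih _ (hl'.trans (by simp)) l' rfl
      · obtain ⟨⟨c, hc, hlc⟩, hfix⟩ := ih l.length (by simp) l rfl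
        have hsum : lam - ((i :: l).map (srefl α coroot)).prod lam =
            Finsupp.linearCombination ℚ α
              (c + Finsupp.single i (coroot i ((l.map (srefl α coroot)).prod lam))) := by
          rw [map_add, ← hlc, Finsupp.linearCombination_single, List.map_cons, List.prod_cons,
            Module.End.mul_apply, srefl_apply]
          abel
        have hsingle : ∀ k, 0 ≤ Finsupp.single i
            (coroot i ((l.map (srefl α coroot)).prod lam)) k :=
          fun k => (Finsupp.single_nonneg.2 hge) k
        refine ⟨⟨_, fun k => add_nonneg (hc k) (hsingle k), hsum⟩, fun h => ?_⟩
        rw [h, sub_self] at hsum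
        have hzero_sum := (linearIndependent_iff.1 hind) _ hsum.symm
        have hc0 : c = 0 := by
          ext k
          have := DFunLike.congr_fun hzero_sum k
          simp only [Finsupp.add_apply, Finsupp.zero_apply] at this ⊢
          linarith [hc k, hsingle k]
        rw [hc0, map_zero, sub_eq_zero] at hlc
        rw [hc0, zero_add, Finsupp.single_eq_zero, ← hlc] at hzero_sum
        rw [List.map_cons, List.prod_cons]
        exact mul_mem (Submonoid.subset_closure ⟨i, hzero_sum, rfl⟩) (hfix hlc.symm)

end Realization

end GKM

open GKM in
/-- The stabilizer of `λ ∈ P^+` in the monoid `T` is the submonoid generated by the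
`r_i` with `α_i^∨(λ) = 0`. -/
theorem stmt1 {I V : Type*} [Countable I] [AddCommGroup V] [Module ℚ V]
    (A : I → I → ℤ) (α : I → V) (coroot : I → (V →ₗ[ℚ] ℚ))
    (hind : LinearIndependent ℚ α)
    (hpair : ∀ i j, coroot i (α j) = (A i j : ℚ))
    (hdiag : ∀ i, A i i = 2 ∨ A i i ≤ 0)
    (hoff : ∀ i j, i ≠ j → A i j ≤ 0)
    (hzero : ∀ i j, A i j = 0 ↔ A j i = 0)
    (lam : V) (hlam : lam ∈ Pplus coroot) :
    ∀ τ : Module.End ℚ V,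
      (τ ∈ Tmon α coroot ∧ τ lam = lam) ↔
        τ ∈ Submonoid.closure (srefl α coroot '' {i | coroot i lam = 0}) := by
  intro τ
  constructor
  · rintro ⟨hτ, hfix⟩
    obtain ⟨l, hl, rfl⟩ := Submonoid.exists_list_of_mem_closure hτ
    obtain ⟨l, rfl⟩ : l ∈ Set.range (List.map (srefl α coroot)) := by
      rw [Set.range_list_map]; exact hl
    exact (sub_word_apply_mem_cone hind hpair hdiag hoff hzero hlam.2 l).2 hfix
  · intro hτ
    refine ⟨Submonoid.closure_mono (Set.image_subset_range _ _) hτ, ?_⟩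
    induction hτ using Submonoid.closure_induction with
    | mem x hx =>
      obtain ⟨i, hi, rfl⟩ := hx
      rw [srefl_apply, show coroot i lam = 0 from hi, zero_smul, sub_zero]
    | one => rfl
    | mul x y _ _ hx hy => rw [Module.End.mul_apply, hy, hx]
end

section
/- Let λ ∈ P^+, μ ∈ Tλ ∩ P^+, i ∈ I^{im}, and w ∈ W with w ≠ id and r_i w μ ∉ P^+. Then there exists j ∈ I^{re} such that r_i w μ = r_j r_i w' μ, where w' := r_j w satisfies ℓ(w') = ℓ(w) − 1. Consequently there exist w_1, w_2 ∈ W with w = w_1 w_2, ℓ(w) = ℓ(w_1) + ℓ(w_2), r_i w_1 = w_1 r_i, the weight μ' := r_i w_2 μ is dominant (μ' ∈ P^+), and r_i w μ = w_1 μ'. -/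
namespace GKM

section AltProd

variable {M : Type*} [Monoid M]

/-- The alternating product `f * g * f * ⋯` with `n` factors. -/
def altProd (f g : M) : ℕ → M
  | 0 => 1
  | n + 1 => f * altProd g f n

lemma altProd_succ_right (f g : M) (n : ℕ) :
    altProd f g (n + 1) = altProd f g n * if Even n then f else g := by
  induction n generalizing f g with
  | zero => simp [altProd]
  | succ n ih =>
    rw [altProd, ih g f, altProd, mul_assoc]
    by_cases h : Even n <;> simp [h, Nat.even_add_one]

lemma altProd_add (f g : M) (m n : ℕ) :
    altProd f g (m + n) =
      altProd f g m * if Even m then altProd f g n else altProd g f n := by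
  induction m generalizing f g with
  | zero => simp [altProd]
  | succ m ih =>
    rw [Nat.add_right_comm, altProd, ih g f, altProd, mul_assoc]
    by_cases h : Even m <;> simp [h, Nat.even_add_one]

end AltProd

variable {I V : Type*} [AddCommGroup V] [Module ℚ V]
variable {A : I → I → ℤ} {α : I → V} {coroot : I → (V →ₗ[ℚ] ℚ)}

lemma coroot_srefl (hpair : ∀ i j, coroot i (α j) = (A i j : ℚ)) (i j : I) (x : V) :
    coroot i (srefl α coroot j x) = coroot i x - coroot j x * A i j := by
  simp [srefl_apply, hpair]

lemma srefl_mul_self (hpair : ∀ i j, coroot i (α j) = (A i j : ℚ)) {j : I}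
    (hj : A j j = 2) : srefl α coroot j * srefl α coroot j = 1 := by
  ext x
  simp only [Module.End.mul_apply, Module.End.one_apply]
  rw [srefl_apply, coroot_srefl hpair, srefl_apply, hj]
  push_cast
  module

lemma srefl_srefl_mul (hpair : ∀ i j, coroot i (α j) = (A i j : ℚ)) {j : I}
    (hj : A j j = 2) (w : Module.End ℚ V) :
    srefl α coroot j * (srefl α coroot j * w) = w := by
  rw [← mul_assoc, srefl_mul_self hpair hj, one_mul]

lemma srefl_commute (hpair : ∀ i j, coroot i (α j) = (A i j : ℚ)) {i j : I}
    (hij : A i j = 0) (hji : A j i = 0) :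
    Commute (srefl α coroot i) (srefl α coroot j) := by
  ext x
  simp only [Module.End.mul_apply]
  rw [srefl_apply, coroot_srefl hpair, srefl_apply j (srefl α coroot i x),
    coroot_srefl hpair, hij, hji, srefl_apply, srefl_apply]
  push_cast
  module

lemma srefl_mem_Wmon {j : I} (hj : A j j = 2) : srefl α coroot j ∈ Wmon A α coroot :=
  Submonoid.subset_closure ⟨j, hj, rfl⟩

/-! ### The length function -/

lemma exists_word {w : Module.End ℚ V} (hw : w ∈ Wmon A α coroot) :
    ∃ l : List I, (∀ m ∈ l, A m m = 2) ∧ (l.map (srefl α coroot)).prod = w := by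
  induction hw using Submonoid.closure_induction with
  | mem x hx =>
    obtain ⟨j, hj, rfl⟩ := hx
    exact ⟨[j], by simpa using hj, by simp⟩
  | one => exact ⟨[], by simp, by simp⟩
  | mul x y _ _ hx hy =>
    obtain ⟨l, hl, rfl⟩ := hx
    obtain ⟨l', hl', rfl⟩ := hy
    refine ⟨l ++ l', fun m hm => ?_, by simp⟩
    exact (List.mem_append.1 hm).elim (hl m) (hl' m)

lemma exists_reduced_word {w : Module.End ℚ V} (hw : w ∈ Wmon A α coroot) :
    ∃ l : List I, (∀ m ∈ l, A m m = 2) ∧ l.length = lenW A α coroot w ∧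
      (l.map (srefl α coroot)).prod = w := by
  obtain ⟨l, hl, hlw⟩ := exists_word hw
  exact Nat.sInf_mem
    (s := {n | ∃ l : List I, (∀ m ∈ l, A m m = 2) ∧ l.length = n ∧
      (l.map (srefl α coroot)).prod = w}) ⟨l.length, l, hl, rfl, hlw⟩

lemma lenW_prod_le {l : List I} (hl : ∀ m ∈ l, A m m = 2) :
    lenW A α coroot (l.map (srefl α coroot)).prod ≤ l.length :=
  Nat.sInf_le ⟨l, hl, rfl, rfl⟩

lemma prod_mem_Wmon {l : List I} (hl : ∀ m ∈ l, A m m = 2) :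
    (l.map (srefl α coroot)).prod ∈ Wmon A α coroot := by
  refine Submonoid.list_prod_mem _ fun x hx => ?_
  obtain ⟨m, hm, rfl⟩ := List.mem_map.1 hx
  exact srefl_mem_Wmon (hl m hm)

lemma lenW_one : lenW A α coroot 1 = 0 :=
  Nat.le_zero.1 (lenW_prod_le (A := A) (α := α) (coroot := coroot) (l := []) (by simp))

lemma lenW_mul_le {v w : Module.End ℚ V} (hv : v ∈ Wmon A α coroot)
    (hw : w ∈ Wmon A α coroot) :
    lenW A α coroot (v * w) ≤ lenW A α coroot v + lenW A α coroot w := by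
  obtain ⟨l, hl, hlen, hlv⟩ := exists_reduced_word hv
  obtain ⟨l', hl', hlen', hlw⟩ := exists_reduced_word hw
  have := lenW_prod_le (A := A) (α := α) (coroot := coroot) (l := l ++ l')
    fun m hm => (List.mem_append.1 hm).elim (hl m) (hl' m)
  rwa [List.map_append, List.prod_append, hlv, hlw, List.length_append, hlen, hlen'] at this

lemma lenW_srefl_le {j : I} (hj : A j j = 2) :
    lenW A α coroot (srefl α coroot j) ≤ 1 := by
  simpa using lenW_prod_le (A := A) (α := α) (coroot := coroot) (l := [j]) (by simpa using hj)

lemma lenW_srefl_mul_le {j : I} (hj : A j j = 2) {w : Module.End ℚ V}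
    (hw : w ∈ Wmon A α coroot) :
    lenW A α coroot (srefl α coroot j * w) ≤ lenW A α coroot w + 1 := by
  have := lenW_mul_le (srefl_mem_Wmon hj) hw
  have := lenW_srefl_le (α := α) (coroot := coroot) hj
  omega

lemma exists_lenW_descent {w : Module.End ℚ V} (hw : w ∈ Wmon A α coroot) (hw1 : w ≠ 1) :
    ∃ j, A j j = 2 ∧ ∃ v ∈ Wmon A α coroot, w = srefl α coroot j * v ∧
      lenW A α coroot v + 1 = lenW A α coroot w := by
  obtain ⟨l, hl, hlen, hlw⟩ := exists_reduced_word hw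
  cases l with
  | nil => exact absurd (by simpa using hlw.symm) hw1
  | cons j l =>
    have hj : A j j = 2 := hl j (by simp)
    have hl' : ∀ m ∈ l, A m m = 2 := fun m hm => hl m (by simp [hm])
    have hmem := prod_mem_Wmon (α := α) (coroot := coroot) hl'
    have hwv : w = srefl α coroot j * (l.map (srefl α coroot)).prod := by simp [← hlw]
    refine ⟨j, hj, _, hmem, hwv, ?_⟩
    have h1 := lenW_prod_le (α := α) (coroot := coroot) hl'
    have h2 := lenW_srefl_mul_le hj hmem
    rw [← hwv] at h2
    rw [List.length_cons] at hlen
    omega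

lemma altProd_mem_Wmon {s t : I} (hs : A s s = 2) (ht : A t t = 2) (n : ℕ) :
    altProd (srefl α coroot s) (srefl α coroot t) n ∈ Wmon A α coroot := by
  induction n generalizing s t with
  | zero => exact one_mem _
  | succ n ih => exact mul_mem (srefl_mem_Wmon hs) (ih ht hs)

lemma lenW_altProd_le {s t : I} (hs : A s s = 2) (ht : A t t = 2) (n : ℕ) :
    lenW A α coroot (altProd (srefl α coroot s) (srefl α coroot t) n) ≤ n := by
  induction n generalizing s t with
  | zero => exact lenW_one.le
  | succ n ih =>
    have := lenW_srefl_mul_le hs (altProd_mem_Wmon (α := α) (coroot := coroot) ht hs n)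
    have := ih ht hs
    rw [altProd]
    omega

/-! ### Rank two computations -/

/-- In the infinite dihedral case, alternating products preserve positivity. -/
lemma altProd_nonneg_of_four_le (hpair : ∀ i j, coroot i (α j) = (A i j : ℚ)) {s t : I}
    (hs : A s s = 2) (ht : A t t = 2) (hst : A s t ≤ 0) (hts : A t s ≤ 0)
    (h4 : 4 ≤ A s t * A t s) {x : V} (hxs : 0 ≤ coroot s x) (hxt : 0 ≤ coroot t x)
    (n : ℕ) {p q : ℚ} (hp : 0 ≤ p) (hq : 0 ≤ q) (hpq : 2 * q ≤ -A s t * p) :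
    0 ≤ p * coroot s (altProd (srefl α coroot t) (srefl α coroot s) n x) +
      q * coroot t (altProd (srefl α coroot t) (srefl α coroot s) n x) := by
  induction n generalizing s t p q with
  | zero => exact add_nonneg (mul_nonneg hp hxs) (mul_nonneg hq hxt)
  | succ n ih =>
    have hst' : (A s t : ℚ) ≤ 0 := by exact_mod_cast hst
    have hts' : (A t s : ℚ) ≤ 0 := by exact_mod_cast hts
    have h4' : (4 : ℚ) ≤ A s t * A t s := by exact_mod_cast h4
    have key := ih ht hs hts hst (by rwa [mul_comm]) hxt hxs
      (p := -A s t * p - q) (q := p) (by linarith) hp (by nlinarith)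
    rw [altProd, Module.End.mul_apply, coroot_srefl hpair, coroot_srefl hpair, ht]
    push_cast
    linarith

/-- In the finite dihedral case there is a braid relation, and shorter alternating products
preserve positivity. -/
lemma exists_braid_of_lt_four (hpair : ∀ i j, coroot i (α j) = (A i j : ℚ)) {s t : I}
    (hs : A s s = 2) (ht : A t t = 2) (hst : A s t ≤ 0) (hts : A t s ≤ 0)
    (hzero : A s t = 0 ↔ A t s = 0) (h4 : A s t * A t s < 4) :
    ∃ M, 0 < M ∧ altProd (srefl α coroot t) (srefl α coroot s) M =
        altProd (srefl α coroot s) (srefl α coroot t) M ∧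
      ∀ n < M, ∀ x : V, 0 ≤ coroot s x → 0 ≤ coroot t x →
        0 ≤ coroot s (altProd (srefl α coroot t) (srefl α coroot s) n x) := by
  have hcases : (A s t = 0 ∧ A t s = 0) ∨ (A s t = -1 ∧ A t s = -1) ∨
      (A s t = -1 ∧ A t s = -2) ∨ (A s t = -2 ∧ A t s = -1) ∨
      (A s t = -1 ∧ A t s = -3) ∨ (A s t = -3 ∧ A t s = -1) := by
    by_cases h0 : A s t = 0
    · exact Or.inl ⟨h0, hzero.1 h0⟩
    have h0' : A t s ≠ 0 := fun h => h0 (hzero.2 h)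
    have h1 : A s t ≤ -1 := by omega
    have h1' : A t s ≤ -1 := by omega
    have h2 : -3 ≤ A s t := by nlinarith
    have h2' : -3 ≤ A t s := by nlinarith
    generalize A s t = a at *
    generalize A t s = b at *
    interval_cases a <;> interval_cases b <;> simp_all
  have hcs : ∀ x, coroot s (srefl α coroot s x) = - coroot s x := fun x => by
    rw [coroot_srefl hpair, hs]; push_cast; ring
  have hct : ∀ x, coroot t (srefl α coroot t x) = - coroot t x := fun x => by
    rw [coroot_srefl hpair, ht]; push_cast; ring
  have hcst : ∀ x, coroot s (srefl α coroot t x) = coroot s x - coroot t x * A s t :=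
    coroot_srefl hpair s t
  have hcts : ∀ x, coroot t (srefl α coroot s x) = coroot t x - coroot s x * A t s :=
    coroot_srefl hpair t s
  obtain ⟨M, hM⟩ : ∃ M, (A s t = 0 ∧ A t s = 0 ∧ M = 2) ∨ (A s t = -1 ∧ A t s = -1 ∧ M = 3) ∨
      (A s t = -1 ∧ A t s = -2 ∧ M = 4) ∨ (A s t = -2 ∧ A t s = -1 ∧ M = 4) ∨
      (A s t = -1 ∧ A t s = -3 ∧ M = 6) ∨ (A s t = -3 ∧ A t s = -1 ∧ M = 6) := by
    rcases hcases with h | h | h | h | h | h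
    exacts [⟨2, by simp [h]⟩, ⟨3, by simp [h]⟩, ⟨4, by simp [h]⟩, ⟨4, by simp [h]⟩,
      ⟨6, by simp [h]⟩, ⟨6, by simp [h]⟩]
  refine ⟨M, by omega, ?_, fun n hn x hxs hxt => ?_⟩
  · ext x
    rcases hM with ⟨h, h', rfl⟩ | ⟨h, h', rfl⟩ | ⟨h, h', rfl⟩ | ⟨h, h', rfl⟩ | ⟨h, h', rfl⟩ |
      ⟨h, h', rfl⟩ <;>
    · simp only [altProd, Module.End.mul_apply, Module.End.one_apply]
      simp only [srefl_apply, map_sub, map_smul, hpair, hs, ht, h, h']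
      push_cast
      module
  · rcases hM with ⟨h, h', rfl⟩ | ⟨h, h', rfl⟩ | ⟨h, h', rfl⟩ | ⟨h, h', rfl⟩ | ⟨h, h', rfl⟩ |
      ⟨h, h', rfl⟩ <;>
    · interval_cases n <;>
      · simp only [altProd, Module.End.mul_apply, Module.End.one_apply, hcs, hct, hcst, hcts, h, h']
        push_cast
        linarith

/-! ### Descents and dominance -/

lemma coroot_nonneg_of_lenW_le (hpair : ∀ i j, coroot i (α j) = (A i j : ℚ))
    (hoff : ∀ i j, i ≠ j → A i j ≤ 0) (hzero : ∀ i j, A i j = 0 ↔ A j i = 0)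
    {μ : V} (hμ : ∀ i, 0 ≤ coroot i μ) {w : Module.End ℚ V} (hw : w ∈ Wmon A α coroot)
    {s : I} (hs : A s s = 2)
    (hlen : lenW A α coroot w ≤ lenW A α coroot (srefl α coroot s * w)) :
    0 ≤ coroot s (w μ) := by
  induction hk : lenW A α coroot w using Nat.strong_induction_on generalizing w s with
  | _ k ih =>
  subst hk
  by_cases hw1 : w = 1
  · simpa [hw1] using hμ s
  obtain ⟨t, ht, v₀, hv₀, hwv₀, hlen₀⟩ := exists_lenW_descent hw hw1
  have hne : s ≠ t := by
    rintro rfl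
    rw [hwv₀, srefl_srefl_mul hpair hs, ← hwv₀] at hlen
    omega
  set rs := srefl α coroot s
  set rt := srefl α coroot t
  let S : ℕ → Prop := fun m => ∃ v ∈ Wmon A α coroot, w = altProd rt rs m * v ∧
    lenW A α coroot v + m = lenW A α coroot w
  classical
  have hS1 : S 1 := ⟨v₀, hv₀, by simpa [altProd] using hwv₀, hlen₀⟩
  have hpos : 1 ≤ lenW A α coroot w := by omega
  obtain ⟨m, ⟨v, hv, hwv, hvlen⟩, hm1, hmax⟩ :
      ∃ m, S m ∧ 1 ≤ m ∧ ¬ S (m + 1) := by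
    refine ⟨Nat.findGreatest S (lenW A α coroot w), Nat.findGreatest_spec hpos hS1,
      Nat.le_findGreatest hpos hS1, fun h => ?_⟩
    have hle : Nat.findGreatest S (lenW A α coroot w) + 1 ≤ lenW A α coroot w := by
      obtain ⟨_, _, _, h⟩ := h
      omega
    have := Nat.le_findGreatest hle h
    omega
  -- the factor `v` has no left descent in `{s, t}`
  have hlast : ∀ z, A z z = 2 → (if Even m then rt else rs) = srefl α coroot z →
      lenW A α coroot v ≤ lenW A α coroot (srefl α coroot z * v) := by
    intro z hz hzm
    by_contra! hlt
    refine hmax ⟨srefl α coroot z * v, mul_mem (srefl_mem_Wmon hz) hv, ?_, ?_⟩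
    · rw [altProd_succ_right, hzm, mul_assoc, srefl_srefl_mul hpair hz, hwv]
    · have := lenW_srefl_mul_le hz (mul_mem (srefl_mem_Wmon hz) hv)
      rw [srefl_srefl_mul hpair hz] at this
      omega
  have hprev : ∀ z, A z z = 2 → (if Even m then rs else rt) = srefl α coroot z →
      lenW A α coroot v ≤ lenW A α coroot (srefl α coroot z * v) := by
    intro z hz hzm
    obtain ⟨n, rfl⟩ : ∃ n, m = n + 1 := ⟨m - 1, by omega⟩
    have hzn : (if Even n then rt else rs) = srefl α coroot z := by
      rw [← hzm]
      by_cases h : Even n <;> simp [h, Nat.even_add_one]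
    rw [altProd_succ_right, hzn, mul_assoc] at hwv
    have h1 := lenW_mul_le (altProd_mem_Wmon (α := α) (coroot := coroot) ht hs n)
      (mul_mem (srefl_mem_Wmon hz) hv)
    rw [← hwv] at h1
    have h2 := lenW_altProd_le (α := α) (coroot := coroot) ht hs n
    omega
  have hvs : 0 ≤ coroot s (v μ) := by
    refine ih _ (by omega) hv hs ?_ rfl
    by_cases h : Even m
    · exact hprev s hs (by simp [h, rs])
    · exact hlast s hs (by simp [h, rs])
  have hvt : 0 ≤ coroot t (v μ) := by
    refine ih _ (by omega) hv ht ?_ rfl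
    by_cases h : Even m
    · exact hlast t ht (by simp [h, rt])
    · exact hprev t ht (by simp [h, rt])
  have hst := hoff s t hne
  have hts := hoff t s hne.symm
  rw [hwv, Module.End.mul_apply]
  by_cases h4 : 4 ≤ A s t * A t s
  · have hst' : (A s t : ℚ) ≤ 0 := by exact_mod_cast hst
    simpa using altProd_nonneg_of_four_le hpair hs ht hst hts h4 hvs hvt m
      zero_le_one le_rfl (by linarith)
  · obtain ⟨M, hM, hbraid, hshort⟩ :=
      exists_braid_of_lt_four hpair hs ht hst hts (hzero s t) (not_le.1 h4)
    rcases lt_or_ge m M with hmM | hmM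
    · exact hshort m hmM _ hvs hvt
    -- otherwise the braid relation makes `s` a left descent of `w`
    exfalso
    obtain ⟨n, rfl⟩ := Nat.exists_eq_add_of_le hmM
    obtain ⟨N, rfl⟩ : ∃ N, M = N + 1 := ⟨M - 1, by omega⟩
    have hrest : ∃ u ∈ Wmon A α coroot, lenW A α coroot u ≤ n ∧
        altProd rt rs (N + 1 + n) = altProd rt rs (N + 1) * u := by
      rw [altProd_add]
      by_cases h : Even (N + 1)
      · exact ⟨_, altProd_mem_Wmon ht hs n, lenW_altProd_le ht hs n, by rw [if_pos h]⟩
      · exact ⟨_, altProd_mem_Wmon hs ht n, lenW_altProd_le hs ht n, by rw [if_neg h]⟩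
    obtain ⟨u, hu, hun, hprod⟩ := hrest
    rw [hprod, hbraid, altProd, mul_assoc, mul_assoc] at hwv
    have hsw : rs * w = altProd rt rs N * (u * v) := by
      rw [hwv, srefl_srefl_mul hpair hs]
    have h1 := lenW_mul_le (altProd_mem_Wmon (α := α) (coroot := coroot) ht hs N)
      (mul_mem hu hv)
    rw [← hsw] at h1
    have h2 := lenW_altProd_le (α := α) (coroot := coroot) ht hs N
    have h3 := lenW_mul_le hu hv
    omega

lemma coroot_imaginary_nonneg (hpair : ∀ i j, coroot i (α j) = (A i j : ℚ))
    (hoff : ∀ i j, i ≠ j → A i j ≤ 0) (hzero : ∀ i j, A i j = 0 ↔ A j i = 0)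
    {μ : V} (hμ : ∀ i, 0 ≤ coroot i μ) {i : I} (hi : A i i ≠ 2)
    {w : Module.End ℚ V} (hw : w ∈ Wmon A α coroot) : 0 ≤ coroot i (w μ) := by
  induction hk : lenW A α coroot w using Nat.strong_induction_on generalizing w with
  | _ k ih =>
  by_cases hw1 : w = 1
  · simpa [hw1] using hμ i
  obtain ⟨j, hj, v, hv, rfl, hlen⟩ := exists_lenW_descent hw hw1
  have hvj := coroot_nonneg_of_lenW_le hpair hoff hzero hμ hv hj (by omega)
  have hvi := ih _ (by omega) hv rfl
  have hij : (A i j : ℚ) ≤ 0 := by exact_mod_cast hoff i j (by rintro rfl; exact hi hj)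
  rw [Module.End.mul_apply, coroot_srefl hpair]
  nlinarith [mul_nonneg hvj (neg_nonneg.2 hij)]

lemma srefl_mem_Pint (hpair : ∀ i j, coroot i (α j) = (A i j : ℚ)) {x : V}
    (hx : x ∈ Pint coroot) (j : I) : srefl α coroot j x ∈ Pint coroot := by
  intro k
  obtain ⟨a, ha⟩ := hx k
  obtain ⟨b, hb⟩ := hx j
  exact ⟨a - b * A k j, by rw [coroot_srefl hpair, ha, hb]; push_cast; ring⟩

lemma apply_mem_Pint (hpair : ∀ i j, coroot i (α j) = (A i j : ℚ)) {w : Module.End ℚ V}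
    (hw : w ∈ Wmon A α coroot) {x : V} (hx : x ∈ Pint coroot) : w x ∈ Pint coroot := by
  induction hw using Submonoid.closure_induction generalizing x with
  | mem y hy =>
    obtain ⟨j, -, rfl⟩ := hy
    exact srefl_mem_Pint hpair hx j
  | one => exact hx
  | mul y z _ _ hy hz => exact hy (hz hx)

/-- If `r_i w μ` is not dominant, then some left descent `r_j` of `w` commutes with `r_i`. -/
lemma exists_commuting_descent (hpair : ∀ i j, coroot i (α j) = (A i j : ℚ))
    (hdiag : ∀ i, A i i = 2 ∨ A i i ≤ 0)
    (hoff : ∀ i j, i ≠ j → A i j ≤ 0) (hzero : ∀ i j, A i j = 0 ↔ A j i = 0)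
    {μ : V} (hμ : μ ∈ Pplus coroot) {i : I} (hi : A i i ≠ 2)
    {w : Module.End ℚ V} (hw : w ∈ Wmon A α coroot)
    (hnd : srefl α coroot i (w μ) ∉ Pplus coroot) :
    ∃ j, A j j = 2 ∧ Commute (srefl α coroot i) (srefl α coroot j) ∧
      lenW A α coroot (srefl α coroot j * w) + 1 = lenW A α coroot w := by
  have him : ∀ {k : I} {v : Module.End ℚ V}, A k k ≠ 2 → v ∈ Wmon A α coroot →
      0 ≤ coroot k (v μ) := fun hk hv => coroot_imaginary_nonneg hpair hoff hzero hμ.2 hk hv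
  obtain ⟨j, hj⟩ : ∃ j, coroot j (srefl α coroot i (w μ)) < 0 := by
    by_contra! h
    exact hnd ⟨srefl_mem_Pint hpair (apply_mem_Pint hpair hw hμ.1) i, h⟩
  rw [coroot_srefl hpair] at hj
  have hwi := him hi hw
  have hji : (A j i : ℚ) ≤ 0 := by
    by_cases h : j = i
    · subst h
      exact_mod_cast (hdiag j).resolve_left hi
    · exact_mod_cast hoff j i h
  have hwji : coroot i (w μ) * A j i ≤ 0 := mul_nonpos_of_nonneg_of_nonpos hwi hji
  have hwj : coroot j (w μ) < 0 := by linarith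
  have hjre : A j j = 2 := by
    by_contra h
    exact absurd (him h hw) (not_le.2 hwj)
  have hjw := mul_mem (srefl_mem_Wmon (α := α) (coroot := coroot) hjre) hw
  refine ⟨j, hjre, ?_, ?_⟩
  · have hij0 : A i j = 0 := by
      by_contra h0
      have hne : i ≠ j := by rintro rfl; exact hi hjre
      have h1 : (A i j : ℚ) ≤ -1 := by
        have := hoff i j hne
        exact_mod_cast (by omega : A i j ≤ -1)
      have h2 : (A j i : ℚ) ≤ -1 := by
        have := hoff j i hne.symm
        have : A j i ≠ 0 := fun h => h0 ((hzero i j).2 h)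
        exact_mod_cast (by omega : A j i ≤ -1)
      have h3 := him hi hjw
      rw [Module.End.mul_apply, coroot_srefl hpair] at h3
      nlinarith
    exact srefl_commute hpair hij0 ((hzero i j).1 hij0)
  · have h1 : lenW A α coroot (srefl α coroot j * w) < lenW A α coroot w := by
      by_contra! h
      exact absurd (coroot_nonneg_of_lenW_le hpair hoff hzero hμ.2 hw hjre h) (not_le.2 hwj)
    have h2 := lenW_srefl_mul_le hjre hjw
    rw [srefl_srefl_mul hpair hjre] at h2
    omega

lemma exists_commuting_factorization (hpair : ∀ i j, coroot i (α j) = (A i j : ℚ))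
    (hdiag : ∀ i, A i i = 2 ∨ A i i ≤ 0)
    (hoff : ∀ i j, i ≠ j → A i j ≤ 0) (hzero : ∀ i j, A i j = 0 ↔ A j i = 0)
    {μ : V} (hμ : μ ∈ Pplus coroot) {i : I} (hi : A i i ≠ 2)
    {w : Module.End ℚ V} (hw : w ∈ Wmon A α coroot) :
    ∃ w₁ ∈ Wmon A α coroot, ∃ w₂ ∈ Wmon A α coroot, w = w₁ * w₂ ∧
      lenW A α coroot w = lenW A α coroot w₁ + lenW A α coroot w₂ ∧
      Commute (srefl α coroot i) w₁ ∧ srefl α coroot i (w₂ μ) ∈ Pplus coroot := by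
  induction hk : lenW A α coroot w using Nat.strong_induction_on generalizing w with
  | _ k ih =>
  subst hk
  by_cases hd : srefl α coroot i (w μ) ∈ Pplus coroot
  · exact ⟨1, one_mem _, w, hw, (one_mul w).symm, by simp [lenW_one], Commute.one_right _, hd⟩
  obtain ⟨j, hj, hcomm, hlen⟩ := exists_commuting_descent hpair hdiag hoff hzero hμ hi hw hd
  obtain ⟨w₁, hw₁, w₂, hw₂, hprod, hadd, hcomm₁, hdom⟩ :=
    ih _ (by omega) (mul_mem (srefl_mem_Wmon hj) hw) rfl
  have hjw₁ := mul_mem (srefl_mem_Wmon (α := α) (coroot := coroot) hj) hw₁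
  have hfact : w = srefl α coroot j * w₁ * w₂ := by
    rw [mul_assoc, ← hprod, srefl_srefl_mul hpair hj]
  refine ⟨_, hjw₁, w₂, hw₂, hfact, ?_, hcomm.mul_right hcomm₁, hdom⟩
  have h1 := lenW_mul_le hjw₁ hw₂
  rw [← hfact] at h1
  have h2 := lenW_srefl_mul_le hj hw₁
  omega

end GKM

open GKM in
/-- Lemma on dominance: if `μ ∈ Tλ ∩ P^+`, `i` is imaginary, `w ∈ W`, `w ≠ id` and
`r_i w μ ∉ P^+`, then `r_i w μ = r_j r_i w' μ` for some real `j`, with `w' = r_j w` of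
length `ℓ(w) - 1`; consequently `w = w₁ w₂` with lengths adding, `r_i w₁ = w₁ r_i`,
`μ' := r_i w₂ μ` dominant and `r_i w μ = w₁ μ'`. -/
theorem stmt3 {I V : Type*} [Countable I] [AddCommGroup V] [Module ℚ V]
    (A : I → I → ℤ) (α : I → V) (coroot : I → (V →ₗ[ℚ] ℚ))
    (hind : LinearIndependent ℚ α)
    (hpair : ∀ i j, coroot i (α j) = (A i j : ℚ))
    (hdiag : ∀ i, A i i = 2 ∨ A i i ≤ 0)
    (hoff : ∀ i j, i ≠ j → A i j ≤ 0)
    (hzero : ∀ i j, A i j = 0 ↔ A j i = 0)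
    (lam : V) (hlam : lam ∈ Pplus coroot)
    (μ : V) (hμT : μ ∈ Torbit α coroot lam) (hμP : μ ∈ Pplus coroot)
    (i : I) (hi : A i i ≠ 2)
    (w : Module.End ℚ V) (hw : w ∈ Wmon A α coroot) (hw1 : w ≠ 1)
    (hnd : srefl α coroot i (w μ) ∉ Pplus coroot) :
    (∃ j : I, A j j = 2 ∧
      srefl α coroot i (w μ) =
        srefl α coroot j (srefl α coroot i ((srefl α coroot j * w) μ)) ∧
      lenW A α coroot (srefl α coroot j * w) + 1 = lenW A α coroot w) ∧
    (∃ w₁ w₂ : Module.End ℚ V, w₁ ∈ Wmon A α coroot ∧ w₂ ∈ Wmon A α coroot ∧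
      w = w₁ * w₂ ∧
      lenW A α coroot w = lenW A α coroot w₁ + lenW A α coroot w₂ ∧
      srefl α coroot i * w₁ = w₁ * srefl α coroot i ∧
      srefl α coroot i (w₂ μ) ∈ Pplus coroot ∧
      srefl α coroot i (w μ) = w₁ (srefl α coroot i (w₂ μ))) := by
  obtain ⟨j, hj, hcomm, hlen⟩ :=
    exists_commuting_descent hpair hdiag hoff hzero hμP hi hw hnd
  refine ⟨⟨j, hj, ?_, hlen⟩, ?_⟩
  · rw [← Module.End.mul_apply, ← Module.End.mul_apply, ← Module.End.mul_apply,
      ← hcomm.eq, mul_assoc, srefl_srefl_mul hpair hj, Module.End.mul_apply]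
  · obtain ⟨w₁, hw₁, w₂, hw₂, hprod, hadd, hcomm₁, hdom⟩ :=
      exists_commuting_factorization hpair hdiag hoff hzero hμP hi hw
    refine ⟨w₁, w₂, hw₁, hw₂, hprod, hadd, hcomm₁.eq, hdom, ?_⟩
    rw [hprod, ← Module.End.mul_apply, ← mul_assoc, hcomm₁.eq]
    rfl
end
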